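/- The number of n-qubit pure stabilizer states equals 2^n · ∏_{k=0}^{n-1}(2^{n-k} + 1), equivalently it satisfies the recurrence N(n) = 2(2^n + 1) N(n-1) with N(1) = 6. -/

import Mathlib

open scoped BigOperators

noncomputable section

/-- The state space of `n` qubits, as complex functions on bitstrings. -/
abbrev QState (n : ℕ) : Type := (Fin n → ZMod 2) → ℂ

/-- Hermitian inner product `⟨ψ|φ⟩` (conjugate-linear in the first argument). -/
def qInner {n : ℕ} (ψ φ : QState n) : ℂ := ∑ b, (starRingEnd ℂ) (ψ b) * φ b

/-- The Pauli operator `i^k · X(x) Z(z)` on `n` qubits. -/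
def pauliFun (n : ℕ) (k : ZMod 4) (x z : Fin n → ZMod 2) : QState n → QState n :=
  fun ψ b => Complex.I ^ k.val * (-1 : ℂ) ^ (∑ i, (z i * (b i + x i)).val) * ψ (b + x)

/-- The `n`-qubit Pauli group, as a set of operators. -/
def PauliGroup (n : ℕ) : Set (QState n → QState n) :=
  {U | ∃ k x z, U = pauliFun n k x z}

/-- The stabilizer group of a state: Pauli operators fixing it. -/
def stabGroup (n : ℕ) (ψ : QState n) : Set (QState n → QState n) :=
  {U | U ∈ PauliGroup n ∧ U ψ = ψ}

/-- An `n`-qubit stabilizer state: a unit vector with `2^n` stabilizers. -/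
def IsStabilizerState (n : ℕ) (ψ : QState n) : Prop :=
  qInner ψ ψ = 1 ∧ (stabGroup n ψ).ncard = 2 ^ n

/-- Two states are parallel (equal up to a global phase/scalar). -/
def Parallel {n : ℕ} (ψ φ : QState n) : Prop := ∃ c : ℂ, φ = c • ψ

/-- The number of stabilizer states, counted up to global phase, satisfying `P`. -/
def stabQuotCard (n : ℕ) (P : QState n → Prop) : ℕ :=
  Nat.card (Quot (fun ψ φ : {ψ : QState n // IsStabilizerState n ψ ∧ P ψ} =>
    Parallel ψ.1 φ.1))

/-! ### Pauli labels form a group -/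

/-- Labels `(k, x, z)` of Pauli operators. -/
@[ext] structure PT (n : ℕ) where
  k : ZMod 4
  x : Fin n → ZMod 2
  z : Fin n → ZMod 2

namespace PT

def equiv (n : ℕ) : PT n ≃ ZMod 4 × (Fin n → ZMod 2) × (Fin n → ZMod 2) where
  toFun p := (p.k, p.x, p.z)
  invFun q := ⟨q.1, q.2.1, q.2.2⟩
  left_inv _ := rfl
  right_inv _ := rfl

instance (n : ℕ) : Finite (PT n) := Finite.of_equiv _ (equiv n).symm

theorem natCard (n : ℕ) : Nat.card (PT n) = 4 * 2 ^ n * 2 ^ n := by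
  rw [Nat.card_congr (equiv n)]
  simp [Nat.card_prod, Nat.card_eq_fintype_card, ZMod.card, mul_assoc]

/-- doubling map `ℤ/2 → ℤ/4`. -/
def dbl (a : ZMod 2) : ZMod 4 := 2 * (a.val : ZMod 4)

theorem dbl_add (a b : ZMod 2) : dbl (a + b) = dbl a + dbl b := by
  revert a b; unfold dbl; decide

theorem dbl_zero : dbl 0 = 0 := by decide

theorem dbl_neg (a : ZMod 2) : dbl (-a) = - dbl a := by
  revert a; unfold dbl; decide

variable {n : ℕ}

instance : Mul (PT n) := ⟨fun p q => ⟨p.k + q.k + dbl (p.z ⬝ᵥ q.x), p.x + q.x, p.z + q.z⟩⟩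
instance : One (PT n) := ⟨⟨0, 0, 0⟩⟩
instance : Inv (PT n) := ⟨fun p => ⟨-p.k + dbl (p.z ⬝ᵥ p.x), -p.x, -p.z⟩⟩

theorem mul_def (p q : PT n) :
    p * q = ⟨p.k + q.k + dbl (p.z ⬝ᵥ q.x), p.x + q.x, p.z + q.z⟩ := rfl
theorem one_def : (1 : PT n) = ⟨0, 0, 0⟩ := rfl
theorem inv_def (p : PT n) : p⁻¹ = ⟨-p.k + dbl (p.z ⬝ᵥ p.x), -p.x, -p.z⟩ := rfl

instance : Group (PT n) := Group.ofLeftAxioms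
  (by
    intro a b c
    simp only [mul_def, add_dotProduct, dotProduct_add, dbl_add]
    ext1
    · ring
    · exact add_assoc _ _ _
    · exact add_assoc _ _ _)
  (by
    intro a
    simp [mul_def, one_def, dbl_zero])
  (by
    intro a
    simp [mul_def, one_def, inv_def, ← dbl_add, CharTwo.add_self_eq_zero, dbl_zero])

/-- the sign character. -/
def sg (a : ZMod 2) : ℂ := (-1) ^ a.val

theorem sg_add (a b : ZMod 2) : sg (a + b) = sg a * sg b := by
  have h : ∀ a b : ZMod 2, (a + b).val = (a.val + b.val) % 2 := by decide
  rw [sg, sg, sg, h, ← pow_add]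
  exact neg_one_pow_eq_pow_mod_two _ |>.symm

theorem sg_zero : sg 0 = 1 := by simp [sg]
theorem sg_one : sg 1 = -1 := by simp [sg, ZMod.val_one]

theorem sg_mul_self (a : ZMod 2) : sg a * sg a = 1 := by
  rw [← sg_add, CharTwo.add_self_eq_zero, sg_zero]

theorem sg_ne_zero (a : ZMod 2) : sg a ≠ 0 := by
  intro h; have := sg_mul_self a; simp [h] at this

theorem sg_inj {a b : ZMod 2} (h : sg a = sg b) : a = b := by
  have h01 : ∀ a : ZMod 2, a = 0 ∨ a = 1 := by decide
  rcases h01 a with rfl | rfl <;> rcases h01 b with rfl | rfl <;>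
    first | rfl | (rw [sg_zero, sg_one] at h; norm_num at h) |
      (rw [sg_one, sg_zero] at h; norm_num at h)

theorem sg_sum {ι : Type*} (s : Finset ι) (f : ι → ZMod 2) :
    sg (∑ i ∈ s, f i) = (-1) ^ (∑ i ∈ s, (f i).val) := by
  classical
  induction s using Finset.induction_on with
  | empty => simp [sg]
  | insert a s ha ih => rw [Finset.sum_insert ha, Finset.sum_insert ha, sg_add, ih, pow_add, sg]

/-- powers of `i`. -/
def ip (k : ZMod 4) : ℂ := Complex.I ^ k.val

theorem ip_add (k l : ZMod 4) : ip (k + l) = ip k * ip l := by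
  unfold ip
  rw [ZMod.val_add, ← pow_add]
  exact (Complex.I_pow_eq_pow_mod _).symm

theorem ip_zero : ip 0 = 1 := by simp [ip]

theorem ip_dbl (a : ZMod 2) : ip (dbl a) = sg a := by
  have h2 : (2 : ZMod 4).val = 2 := rfl
  have h01 : ∀ a : ZMod 2, a = 0 ∨ a = 1 := by decide
  rcases h01 a with rfl | rfl
  · simp [ip, dbl, sg]
  · simp [ip, dbl, sg, ZMod.val_one, h2]

theorem ip_ne_zero (k : ZMod 4) : ip k ≠ 0 := by simp [ip]

theorem ip_inj {k l : ZMod 4} (h : ip k = ip l) : k = l := by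
  have h1 : ip (k - l) = 1 := by
    have : ip (k - l) * ip l = ip l := by rw [← ip_add, sub_add_cancel, h]
    exact mul_right_cancel₀ (ip_ne_zero l) (by rw [this, one_mul])
  have h2 : ∀ m : ZMod 4, ip m = 1 → m = 0 := by
    intro m hm
    have h3 : m.val < 4 := ZMod.val_lt m
    rw [← ZMod.val_eq_zero]
    unfold ip at hm
    generalize m.val = j at *
    interval_cases j
    · rfl
    · simp [Complex.ext_iff] at hm
    · norm_num [Complex.ext_iff] at hm
    · simp [pow_succ, Complex.ext_iff] at hm
  exact sub_eq_zero.mp (h2 _ h1)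

instance : SMul (PT n) (QState n) :=
  ⟨fun p ψ => fun b => ip p.k * sg (p.z ⬝ᵥ (b + p.x)) * ψ (b + p.x)⟩

theorem act_apply (p : PT n) (ψ : QState n) (b : Fin n → ZMod 2) :
    (p • ψ) b = ip p.k * sg (p.z ⬝ᵥ (b + p.x)) * ψ (b + p.x) := rfl

theorem act_eq (p : PT n) (ψ : QState n) : p • ψ = pauliFun n p.k p.x p.z ψ := by
  funext b
  rw [act_apply, pauliFun, dotProduct, sg_sum]
  rfl

instance : MulAction (PT n) (QState n) where
  one_smul ψ := by
    funext b
    simp [act_apply, one_def, ip_zero, sg_zero]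
  mul_smul p q ψ := by
    funext b
    simp only [act_apply, mul_def, ip_add, ip_dbl, dotProduct_add, add_dotProduct, sg_add,
      add_assoc]
    have := sg_mul_self (p.z ⬝ᵥ q.x)
    linear_combination (ip p.k * ip q.k * sg (p.z ⬝ᵥ b) * sg (p.z ⬝ᵥ p.x) * sg (q.z ⬝ᵥ b)
      * sg (q.z ⬝ᵥ p.x) * sg (q.z ⬝ᵥ q.x) * ψ (b + (p.x + q.x))) * this

theorem act_smul (p : PT n) (c : ℂ) (ψ : QState n) : p • (c • ψ) = c • (p • ψ) := by
  funext b
  simp only [act_apply, Pi.smul_apply, smul_eq_mul]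
  ring

theorem act_zero (p : PT n) : p • (0 : QState n) = 0 := by
  funext b
  simp [act_apply]

theorem act_eq_zero {p : PT n} {ψ : QState n} : p • ψ = 0 ↔ ψ = 0 := by
  constructor
  · intro h
    have := congrArg (fun φ => p⁻¹ • φ) h
    simpa [act_zero] using this
  · rintro rfl; exact act_zero p

/-- commutation up to sign -/
theorem act_comm (p q : PT n) : ∃ a : ZMod 2, ∀ ψ : QState n, p • q • ψ = sg a • q • p • ψ := by
  refine ⟨p.z ⬝ᵥ q.x + q.z ⬝ᵥ p.x, fun ψ => ?_⟩
  funext b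
  simp only [act_apply, Pi.smul_apply, smul_eq_mul, dotProduct_add, sg_add]
  have h1 := sg_mul_self (p.z ⬝ᵥ q.x)
  have h2 := sg_mul_self (q.z ⬝ᵥ p.x)
  rw [show b + q.x + p.x = b + p.x + q.x by abel]
  linear_combination (-(ip p.k * ip q.k * sg (p.z ⬝ᵥ b) * sg (p.z ⬝ᵥ p.x) * sg (q.z ⬝ᵥ b)
      * sg (q.z ⬝ᵥ p.x) * sg (q.z ⬝ᵥ q.x) * ψ (b + p.x + q.x))) * h1

theorem act_sq (p : PT n) : ∃ a : ZMod 2, ∀ ψ : QState n, p • p • ψ = sg a • ψ := by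
  have hk : ∃ c : ZMod 2, dbl c = p.k + p.k := by
    generalize p.k = k
    revert k; unfold dbl; decide
  obtain ⟨c, hc⟩ := hk
  refine ⟨c + p.z ⬝ᵥ p.x, fun ψ => ?_⟩
  rw [← mul_smul]
  funext b
  have hx : p.x + p.x = 0 := by funext i; exact CharTwo.add_self_eq_zero _
  have hz : p.z + p.z = 0 := by funext i; exact CharTwo.add_self_eq_zero _
  simp only [act_apply, mul_def, hx, hz, ← hc, ip_add, ip_dbl, zero_dotProduct, sg_zero, sg_add,
    add_zero, Pi.smul_apply, smul_eq_mul, mul_one]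

theorem pauliFun_inj {p q : PT n}
    (h : pauliFun n p.k p.x p.z = pauliFun n q.k q.x q.z) : p = q := by
  have h0 : ∀ ψ : QState n, p • ψ = q • ψ := fun ψ => by rw [act_eq, act_eq, h]
  have hx : p.x = q.x := by
    by_contra hne
    have := congrFun (h0 (Pi.single p.x 1)) 0
    simp only [act_apply, zero_add, Pi.single_eq_same, Pi.single_eq_of_ne (Ne.symm hne)] at this
    simp [ip_ne_zero, sg_ne_zero] at this
  have h1 : ∀ b, ip p.k * sg (p.z ⬝ᵥ b) = ip q.k * sg (q.z ⬝ᵥ b) := by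
    intro b
    have := congrFun (h0 (fun _ => 1)) (b - p.x)
    simpa only [act_apply, ← hx, sub_add_cancel, mul_one] using this
  have hk : p.k = q.k := by
    have := h1 0
    simp only [dotProduct_zero, sg_zero, mul_one] at this
    exact ip_inj this
  have hz : p.z = q.z := by
    funext i
    have := h1 (Pi.single i 1)
    rw [hk] at this
    have := sg_inj (mul_left_cancel₀ (ip_ne_zero _) this)
    simpa using this
  ext1 <;> assumption

end PT

open PT

/-- labels of the stabilizers. -/
def S {n : ℕ} (ψ : QState n) : Set (PT n) := {p | p • ψ = ψ}

theorem stabGroup_ncard {n : ℕ} (ψ : QState n) : (stabGroup n ψ).ncard = (S ψ).ncard := by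
  symm
  refine Set.ncard_congr (fun p _ => pauliFun n p.k p.x p.z) ?_ ?_ ?_
  · intro p hp
    exact ⟨⟨_, _, _, rfl⟩, by rw [← act_eq]; exact hp⟩
  · intro p q _ _ h
    exact pauliFun_inj h
  · rintro U ⟨⟨k, x, z, rfl⟩, h⟩
    exact ⟨⟨k, x, z⟩, by rw [S, Set.mem_ofPred_eq, act_eq]; exact h, rfl⟩

theorem S_smul {n : ℕ} {c : ℂ} (hc : c ≠ 0) (ψ : QState n) : S (c • ψ) = S ψ := by
  ext p
  simp only [S, Set.mem_ofPred_eq, act_smul]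
  exact (smul_right_injective _ hc).eq_iff

/-- transporters have the size of the stabilizer -/
theorem ncard_transport {n : ℕ} (ψ : QState n) (q : PT n) :
    {p : PT n | p • ψ = q • ψ}.ncard = (S ψ).ncard := by
  symm
  refine Set.ncard_congr (fun p _ => q * p) ?_ ?_ ?_
  · intro p hp
    have hp' : p • ψ = ψ := hp
    simp [mul_smul, hp']
  · intro a b _ _ h
    exact mul_left_cancel h
  · intro p hp
    have hp' : p • ψ = q • ψ := hp
    exact ⟨q⁻¹ * p, by simp [S, mul_smul, hp'], by simp⟩

/-! ### Splitting off one qubit -/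

/-- assemble a state from its two halves. -/
def glue {n : ℕ} (φ : ZMod 2 → QState n) : QState (n + 1) := fun b => φ (b 0) (Fin.tail b)

def half {n : ℕ} (Ψ : QState (n + 1)) (a : ZMod 2) : QState n := fun b => Ψ (Fin.cons a b)

theorem mk_half {n : ℕ} (Ψ : QState (n + 1)) : glue (half Ψ) = Ψ := by
  funext b
  simp [glue, half]

theorem half_mk {n : ℕ} (φ : ZMod 2 → QState n) : half (glue φ) = φ := by
  funext a b
  simp [glue, half]

theorem mk_inj {n : ℕ} {φ φ' : ZMod 2 → QState n} : glue φ = glue φ' ↔ φ = φ' :=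
  ⟨fun h => by rw [← half_mk φ, h, half_mk], fun h => by rw [h]⟩

/-- prepend a one-qubit Pauli. -/
def ext1 {n : ℕ} (x0 z0 : ZMod 2) (p : PT n) : PT (n + 1) :=
  ⟨p.k, Fin.cons x0 p.x, Fin.cons z0 p.z⟩

theorem ext1_act {n : ℕ} (x0 z0 : ZMod 2) (p : PT n) (φ : ZMod 2 → QState n) :
    ext1 x0 z0 p • glue φ = glue (fun a => sg (z0 * (a + x0)) • p • φ (a + x0)) := by
  funext b
  have h : (ext1 x0 z0 p).z ⬝ᵥ (b + (ext1 x0 z0 p).x)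
      = z0 * (b 0 + x0) + p.z ⬝ᵥ (Fin.tail b + p.x) := by
    simp [ext1, dotProduct, Fin.sum_univ_succ, Fin.tail]
  have h' : Fin.tail (b + (ext1 x0 z0 p).x) = Fin.tail b + p.x := by
    funext i
    simp [ext1, Fin.tail]
  have h'' : (b + (ext1 x0 z0 p).x) 0 = b 0 + x0 := by simp [ext1]
  rw [act_apply, h, sg_add]
  simp only [glue, h', h'', Pi.smul_apply, smul_eq_mul, act_apply]
  simp only [ext1]
  ring

theorem zfun_ext {α : Type*} {f g : ZMod 2 → α} : f = g ↔ f 0 = g 0 ∧ f 1 = g 1 := by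
  constructor
  · rintro rfl; exact ⟨rfl, rfl⟩
  · rintro ⟨h0, h1⟩
    funext a
    fin_cases a
    · exact h0
    · exact h1

def SA {n : ℕ} (φ : ZMod 2 → QState n) : Set (ZMod 2 × PT n) :=
  {t | t.2 • φ 0 = φ 0 ∧ sg t.1 • t.2 • φ 1 = φ 1}

def SB {n : ℕ} (φ : ZMod 2 → QState n) : Set (ZMod 2 × PT n) :=
  {t | sg t.1 • t.2 • φ 1 = φ 0 ∧ t.2 • φ 0 = φ 1}

theorem ext1_inj {n : ℕ} {x x' z z' : ZMod 2} {p p' : PT n} (h : ext1 x z p = ext1 x' z' p') :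
    x = x' ∧ z = z' ∧ p = p' := by
  simp only [ext1, PT.mk.injEq, Fin.cons_inj] at h
  obtain ⟨hk, ⟨hx, hpx⟩, hz, hpz⟩ := h
  exact ⟨hx, hz, PT.ext hk hpx hpz⟩

theorem S_mk {n : ℕ} (φ : ZMod 2 → QState n) : (S (glue φ)).ncard = (SA φ).ncard + (SB φ).ncard := by
  have h11 : (1 : ZMod 2) + 1 = 0 := by decide
  have hA : ∀ z (p : PT n), ext1 0 z p ∈ S (glue φ) ↔ (z, p) ∈ SA φ := by
    intro z p
    simp [S, SA, ext1_act, mk_inj, zfun_ext, sg_zero]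
  have hB : ∀ z (p : PT n), ext1 1 z p ∈ S (glue φ) ↔ (z, p) ∈ SB φ := by
    intro z p
    simp [S, SB, ext1_act, mk_inj, zfun_ext, sg_zero, h11]
  have hS : S (glue φ) = (fun t : ZMod 2 × PT n => ext1 0 t.1 t.2) '' SA φ ∪
      (fun t : ZMod 2 × PT n => ext1 1 t.1 t.2) '' SB φ := by
    ext p
    obtain ⟨k, x, z⟩ := p
    have hp : (⟨k, x, z⟩ : PT (n + 1)) = ext1 (x 0) (z 0) ⟨k, Fin.tail x, Fin.tail z⟩ := by
      simp [ext1]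
    rw [hp]
    generalize (⟨k, Fin.tail x, Fin.tail z⟩ : PT n) = q
    generalize z 0 = z0
    generalize x 0 = x0
    constructor
    · intro h
      fin_cases x0
      · exact Or.inl ⟨(z0, q), (hA _ _).1 h, rfl⟩
      · exact Or.inr ⟨(z0, q), (hB _ _).1 h, rfl⟩
    · rintro (⟨⟨z', q'⟩, h, he⟩ | ⟨⟨z', q'⟩, h, he⟩)
      · rw [← he]; exact (hA _ _).2 h
      · rw [← he]; exact (hB _ _).2 h
  rw [hS, Set.ncard_union_eq _ (Set.toFinite _) (Set.toFinite _), Set.ncard_image_of_injective,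
    Set.ncard_image_of_injective]
  · rintro ⟨a, b⟩ ⟨c, d⟩ h
    obtain ⟨_, h1, h2⟩ := ext1_inj h
    exact Prod.ext h1 h2
  · rintro ⟨a, b⟩ ⟨c, d⟩ h
    obtain ⟨_, h1, h2⟩ := ext1_inj h
    exact Prod.ext h1 h2
  · rw [Set.disjoint_left]
    rintro _ ⟨s, _, rfl⟩ ⟨t, _, h⟩
    exact absurd (ext1_inj h).1 (by decide)

theorem ncard_prod_two {n : ℕ} (s : Set (PT n)) :
    ((Set.univ : Set (ZMod 2)) ×ˢ s).ncard = 2 * s.ncard := by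
  rw [Set.ncard_prod, Set.ncard_univ]
  simp

theorem sg_smul_sg_smul {n : ℕ} (a : ZMod 2) (ψ : QState n) : sg a • sg a • ψ = ψ := by
  rw [smul_smul, sg_mul_self, one_smul]

theorem S_mk_left {n : ℕ} {φ : ZMod 2 → QState n} (h1 : φ 1 = 0) (h0 : φ 0 ≠ 0) :
    (S (glue φ)).ncard = 2 * (S (φ 0)).ncard := by
  have hB : SB φ = ∅ := by
    ext t
    simp only [SB, Set.mem_ofPred_eq, Set.mem_empty_iff_false, iff_false, h1, act_eq_zero]
    exact fun h => h0 h.2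
  have hA : SA φ = Set.univ ×ˢ S (φ 0) := by
    ext t
    simp [SA, S, h1, act_zero]
  rw [S_mk, hB, hA, ncard_prod_two, Set.ncard_empty, add_zero]

theorem S_mk_right {n : ℕ} {φ : ZMod 2 → QState n} (h0 : φ 0 = 0) (h1 : φ 1 ≠ 0) :
    (S (glue φ)).ncard = 2 * (S (φ 1)).ncard := by
  have hB : SB φ = ∅ := by
    ext t
    simp only [SB, Set.mem_ofPred_eq, Set.mem_empty_iff_false, iff_false, h0, act_zero]
    exact fun h => h1 h.2.symm
  rw [S_mk, hB, Set.ncard_empty, add_zero, ← ncard_prod_two]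
  have key : ∀ (a : ZMod 2) (p : PT n) (ψ : QState n),
      (⟨p.k + dbl a, p.x, p.z⟩ : PT n) • ψ = sg a • p • ψ := by
    intro a p ψ
    funext b
    simp only [act_apply, ip_add, ip_dbl, Pi.smul_apply, smul_eq_mul]
    ring
  refine Set.ncard_congr (fun t _ => (t.1, ⟨t.2.k + dbl t.1, t.2.x, t.2.z⟩)) ?_ ?_ ?_
  · rintro ⟨a, p⟩ ⟨_, h⟩
    refine ⟨trivial, ?_⟩
    rw [S, Set.mem_ofPred_eq, key]
    exact h
  · rintro ⟨a, p⟩ ⟨b, q⟩ _ _ h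
    simp only [Prod.mk.injEq, PT.mk.injEq] at h
    obtain ⟨rfl, h1, h2, h3⟩ := h
    exact Prod.ext rfl (PT.ext (add_right_cancel h1) h2 h3)
  · rintro ⟨a, p⟩ ⟨_, h⟩
    have h' : p • φ 1 = φ 1 := h
    refine ⟨(a, ⟨p.k + dbl a, p.x, p.z⟩), ⟨?_, ?_⟩, ?_⟩
    · simp [h0, act_zero]
    · simp only [key, h', sg_smul_sg_smul]
    · have : dbl a + dbl a = 0 := by rw [← dbl_add, CharTwo.add_self_eq_zero, dbl_zero]
      simp [add_assoc, this]

theorem sg_smul_inj {n : ℕ} {a b : ZMod 2} {ψ : QState n} (hψ : ψ ≠ 0)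
    (h : sg a • ψ = sg b • ψ) : a = b :=
  sg_inj (smul_left_injective ℂ hψ h)

theorem SA_injOn {n : ℕ} {φ : ZMod 2 → QState n} (h1 : φ 1 ≠ 0) :
    Set.InjOn Prod.snd (SA φ) := by
  rintro ⟨a, p⟩ ⟨_, ha⟩ ⟨b, q⟩ ⟨_, hb⟩ (rfl : p = q)
  refine Prod.ext ?_ rfl
  exact sg_smul_inj (mt act_eq_zero.1 h1) (ha.trans hb.symm)

theorem S_mk_le {n : ℕ} {φ : ZMod 2 → QState n} (h1 : φ 1 ≠ 0)
    (hn : ¬ ∃ q : PT n, φ 1 = q • φ 0) :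
    (S (glue φ)).ncard ≤ (S (φ 0)).ncard := by
  have hB : SB φ = ∅ := by
    ext t
    simp only [Set.mem_empty_iff_false, iff_false]
    exact fun h => hn ⟨t.2, h.2.symm⟩
  rw [S_mk, hB, Set.ncard_empty, add_zero]
  exact Set.ncard_le_ncard_of_injOn Prod.snd (fun t ht => ht.1) (SA_injOn h1) (Set.toFinite _)

theorem S_mk_both {n : ℕ} {φ : ZMod 2 → QState n} (h0 : φ 0 ≠ 0) (q : PT n)
    (hq : φ 1 = q • φ 0) :
    (S (glue φ)).ncard = 2 * (S (φ 0)).ncard := by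
  have h1 : φ 1 ≠ 0 := by rw [hq]; exact mt act_eq_zero.1 h0
  have hA : (SA φ).ncard = (S (φ 0)).ncard := by
    refine Set.ncard_congr (fun t _ => t.2) (fun t ht => ht.1)
      (fun s t hs ht h => SA_injOn h1 hs ht h) ?_
    intro p hp
    have hp' : p • φ 0 = φ 0 := hp
    obtain ⟨a, ha⟩ := act_comm p q
    refine ⟨(a, p), ⟨hp', ?_⟩, rfl⟩
    simp only [hq, ha, sg_smul_sg_smul, hp']
  have hB : (SB φ).ncard = (S (φ 0)).ncard := by
    rw [← ncard_transport (φ 0) q, ← hq]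
    refine Set.ncard_congr (fun t _ => t.2) (fun t ht => ht.2) ?_ ?_
    · rintro ⟨a, p⟩ ⟨b, p'⟩ ⟨ha, _⟩ ⟨hb, _⟩ (rfl : p = p')
      refine Prod.ext ?_ rfl
      exact sg_smul_inj (mt act_eq_zero.1 h1) (ha.trans hb.symm)
    · intro p hp
      have hp' : p • φ 0 = φ 1 := hp
      obtain ⟨a, ha⟩ := act_sq p
      refine ⟨(a, p), ⟨?_, hp'⟩, rfl⟩
      simp only [← hp', ha, sg_smul_sg_smul]
  rw [S_mk, hA, hB, two_mul]

theorem S_zero_qubits {ψ : QState 0} (h : ψ ≠ 0) : (S ψ).ncard = 1 := by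
  rw [Set.ncard_eq_one]
  refine ⟨1, ?_⟩
  ext p
  simp only [Set.mem_singleton_iff]
  constructor
  · intro hp
    have hp' : p • ψ = ψ := hp
    have h0 : ψ 0 ≠ 0 := by
      intro h0; apply h; funext b; rw [Subsingleton.elim b 0, h0]; rfl
    have := congrFun hp' 0
    rw [act_apply, Subsingleton.elim (0 + p.x) 0, dotProduct_zero, sg_zero, mul_one] at this
    have h2 : ip p.k = ip 0 := by
      rw [ip_zero]; exact mul_right_cancel₀ h0 (by rw [this, one_mul])
    exact PT.ext (ip_inj h2) (Subsingleton.elim _ _) (Subsingleton.elim _ _)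
  · rintro rfl
    exact one_smul _ ψ

theorem mk_eq_zero {n : ℕ} {φ : ZMod 2 → QState n} : glue φ = 0 ↔ φ 0 = 0 ∧ φ 1 = 0 := by
  have : (0 : QState (n + 1)) = glue 0 := rfl
  rw [this, mk_inj, zfun_ext]; rfl

theorem S_le {n : ℕ} {ψ : QState n} (h : ψ ≠ 0) : (S ψ).ncard ≤ 2 ^ n := by
  induction n with
  | zero => rw [S_zero_qubits h, pow_zero]
  | succ n ih =>
    rw [← mk_half ψ] at h ⊢
    generalize half ψ = φ at *
    rw [pow_succ']
    by_cases h0 : φ 0 = 0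
    · have h1 : φ 1 ≠ 0 := fun h1 => h (mk_eq_zero.2 ⟨h0, h1⟩)
      rw [S_mk_right h0 h1]
      have := ih h1
      omega
    · have := ih h0
      by_cases h1 : φ 1 = 0
      · rw [S_mk_left h1 h0]; omega
      · by_cases hq : ∃ q : PT n, φ 1 = q • φ 0
        · obtain ⟨q, hq⟩ := hq
          rw [S_mk_both h0 q hq]; omega
        · have := S_mk_le h1 hq
          omega

/-- Unnormalized stabilizer states. -/
def T {n : ℕ} (ψ : QState n) : Prop := ψ ≠ 0 ∧ (S ψ).ncard = 2 ^ n

theorem T_smul {n : ℕ} {c : ℂ} (hc : c ≠ 0) {ψ : QState n} : T (c • ψ) ↔ T ψ := by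
  simp [T, S_smul hc, hc]

theorem T_mk {n : ℕ} {φ : ZMod 2 → QState n} : T (glue φ) ↔
    (T (φ 0) ∧ φ 1 = 0) ∨ (φ 0 = 0 ∧ T (φ 1)) ∨ (T (φ 0) ∧ ∃ q : PT n, φ 1 = q • φ 0) := by
  have hpos : 0 < 2 ^ n := by positivity
  by_cases h0 : φ 0 = 0
  · have hT : ¬ T (φ 0) := fun h => h.1 h0
    by_cases h1 : φ 1 = 0
    · have hT1 : ¬ T (φ 1) := fun h => h.1 h1
      have : ¬ T (glue φ) := fun h => h.1 (mk_eq_zero.2 ⟨h0, h1⟩)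
      tauto
    · have : T (glue φ) ↔ T (φ 1) := by
        simp [T, mk_eq_zero, h0, h1, S_mk_right h0 h1, pow_succ']
      tauto
  · by_cases h1 : φ 1 = 0
    · have : T (glue φ) ↔ T (φ 0) := by
        simp [T, mk_eq_zero, h0, h1, S_mk_left h1 h0, pow_succ']
      have hq : ¬ ∃ q : PT n, φ 1 = q • φ 0 := by
        rintro ⟨q, hq⟩
        rw [h1] at hq
        exact h0 (act_eq_zero.1 hq.symm)
      tauto
    · by_cases hq : ∃ q : PT n, φ 1 = q • φ 0
      · have : T (glue φ) ↔ T (φ 0) := by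
          obtain ⟨q, hq⟩ := hq
          simp [T, mk_eq_zero, h0, S_mk_both h0 q hq, pow_succ']
        tauto
      · have : ¬ T (glue φ) := by
          intro h
          have h2 := h.2
          have h3 := S_mk_le h1 hq
          have h4 := S_le h0
          rw [pow_succ'] at h2
          omega
        tauto

/-! ### Canonical representatives -/

/-- Canonical representatives: the first nonzero amplitude is `1`. -/
def R : (n : ℕ) → Set (QState n)
  | 0 => {fun _ => 1}
  | n + 1 => {Ψ | (half Ψ 0 ∈ R n ∧ half Ψ 1 = 0) ∨ (half Ψ 0 = 0 ∧ half Ψ 1 ∈ R n) ∨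
      (half Ψ 0 ∈ R n ∧ ∃ q : PT n, half Ψ 1 = q • half Ψ 0)}

theorem R_T {n : ℕ} {ψ : QState n} (h : ψ ∈ R n) : T ψ := by
  induction n with
  | zero =>
    have h' : ψ = fun _ => 1 := h
    have : ψ ≠ 0 := by
      rw [h']; intro h; simpa using congrFun h 0
    exact ⟨this, S_zero_qubits this⟩
  | succ n ih =>
    rw [← mk_half ψ, T_mk]
    rcases h with ⟨h1, h2⟩ | ⟨h1, h2⟩ | ⟨h1, h2⟩
    · exact Or.inl ⟨ih h1, h2⟩
    · exact Or.inr (Or.inl ⟨h1, ih h2⟩)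
    · exact Or.inr (Or.inr ⟨ih h1, h2⟩)

theorem half_smul {n : ℕ} (c : ℂ) (Ψ : QState (n + 1)) (a : ZMod 2) :
    half (c • Ψ) a = c • half Ψ a := rfl

theorem exists_R {n : ℕ} {ψ : QState n} (h : T ψ) : ∃ c : ℂ, c ≠ 0 ∧ c • ψ ∈ R n := by
  induction n with
  | zero =>
    have h0 : ψ 0 ≠ 0 := by
      intro h0; apply h.1; funext b; rw [Subsingleton.elim b 0, h0]; rfl
    refine ⟨(ψ 0)⁻¹, inv_ne_zero h0, ?_⟩
    show _ = _
    funext b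
    rw [Subsingleton.elim b 0]
    exact inv_mul_cancel₀ h0
  | succ n ih =>
    rw [← mk_half ψ, T_mk] at h
    rcases h with ⟨h1, h2⟩ | ⟨h1, h2⟩ | ⟨h1, q, h2⟩
    · obtain ⟨c, hc, h⟩ := ih h1
      exact ⟨c, hc, Or.inl ⟨h, by rw [half_smul, h2, smul_zero]⟩⟩
    · obtain ⟨c, hc, h⟩ := ih h2
      exact ⟨c, hc, Or.inr (Or.inl ⟨by rw [half_smul, h1, smul_zero], h⟩)⟩
    · obtain ⟨c, hc, h⟩ := ih h1
      exact ⟨c, hc, Or.inr (Or.inr ⟨h, q, by rw [half_smul, half_smul, h2, act_smul]⟩)⟩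

theorem R_unique {n : ℕ} {ψ : QState n} {c : ℂ} (hc : c ≠ 0) (h : ψ ∈ R n) (h' : c • ψ ∈ R n) :
    c = 1 := by
  induction n with
  | zero =>
    have h1 : ψ = fun _ => 1 := h
    have h2 : c • ψ = fun _ => 1 := h'
    rw [h1] at h2
    simpa using congrFun h2 0
  | succ n ih =>
    have hz : (0 : QState n) ∉ R n := fun h => (R_T h).1 rfl
    have e : half ψ 0 = 0 ↔ half (c • ψ) 0 = 0 := by
      rw [half_smul]; simp [hc]
    have a1 : half ψ 0 ∈ R n ∨ (half ψ 0 = 0 ∧ half ψ 1 ∈ R n) := by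
      rcases h with h | h | h
      · exact Or.inl h.1
      · exact Or.inr h
      · exact Or.inl h.1
    have a2 : half (c • ψ) 0 ∈ R n ∨ (half (c • ψ) 0 = 0 ∧ half (c • ψ) 1 ∈ R n) := by
      rcases h' with h | h | h
      · exact Or.inl h.1
      · exact Or.inr h
      · exact Or.inl h.1
    rcases a1 with a1 | ⟨a1, b1⟩
    · rcases a2 with a2 | ⟨a2, b2⟩
      · exact ih a1 a2
      · rw [e.2 a2] at a1; exact absurd a1 hz
    · rcases a2 with a2 | ⟨a2, b2⟩
      · rw [e.1 a1] at a2; exact absurd a2 hz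
      · exact ih b1 b2

theorem card_orbit {n : ℕ} {ψ : QState n} (h : T ψ) :
    Nat.card (MulAction.orbit (PT n) ψ) = 4 * 2 ^ n := by
  have h1 := Nat.card_congr (MulAction.orbitProdStabilizerEquivGroup (PT n) ψ)
  have h2 : Nat.card (MulAction.stabilizer (PT n) ψ) = 2 ^ n := h.2
  rw [Nat.card_prod, h2, PT.natCard] at h1
  exact Nat.eq_of_mul_eq_mul_right (by positivity) h1

instance finite_orbit {n : ℕ} (ψ : QState n) : Finite (MulAction.orbit (PT n) ψ) :=
  Set.finite_range _

/-- assemble from a pair. -/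
def pr {n : ℕ} (a b : QState n) : ZMod 2 → QState n := fun i => if i = 0 then a else b

@[simp] theorem pr_zero {n : ℕ} (a b : QState n) : pr a b 0 = a := by simp [pr]
@[simp] theorem pr_one {n : ℕ} (a b : QState n) : pr a b 1 = b := by simp [pr]

def Rmap (n : ℕ) :
    (R n ⊕ R n) ⊕ (Σ r : R n, MulAction.orbit (PT n) r.1) → R (n + 1)
  | Sum.inl (Sum.inl r) => ⟨glue (pr r 0), by
      left; rw [half_mk]; simp⟩
  | Sum.inl (Sum.inr r) => ⟨glue (pr 0 r), by
      right; left; rw [half_mk]; simp⟩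
  | Sum.inr ⟨r, o⟩ => ⟨glue (pr r o), by
      right; right; rw [half_mk]
      obtain ⟨o, q, hq⟩ := o
      simp only [pr_zero, pr_one]
      exact ⟨r.2, q, hq.symm⟩⟩

theorem mk_pr_inj {n : ℕ} {a b c d : QState n} (h : glue (pr a b) = glue (pr c d)) :
    a = c ∧ b = d := by
  rw [mk_inj, zfun_ext] at h
  simpa using h

theorem Rmap_bij (n : ℕ) : Function.Bijective (Rmap n) := by
  have hz : ∀ r : R n, r.1 ≠ 0 := fun r => (R_T r.2).1
  have hz' : ∀ (r : R n) (o : MulAction.orbit (PT n) r.1), o.1 ≠ 0 := by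
    rintro r ⟨o, q, rfl⟩
    exact mt act_eq_zero.1 (hz r)
  constructor
  · rintro ((r | r) | ⟨r, o⟩) ((s | s) | ⟨s, u⟩) h <;>
      obtain ⟨h1, h2⟩ := mk_pr_inj (congrArg Subtype.val h)
    · rw [Subtype.ext h1]
    · exact absurd h1 (hz r)
    · exact absurd h2.symm (hz' s u)
    · exact absurd h1.symm (hz s)
    · rw [Subtype.ext h2]
    · exact absurd h1.symm (hz s)
    · exact absurd h2 (hz' r o)
    · exact absurd h1 (hz r)
    · obtain rfl := Subtype.ext h1
      rw [Subtype.ext h2]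
  · have hmk : ∀ Ψ : QState (n + 1), glue (pr (half Ψ 0) (half Ψ 1)) = Ψ := by
      intro Ψ
      conv_rhs => rw [← mk_half Ψ]
      rw [mk_inj, zfun_ext]; simp
    rintro ⟨Ψ, ⟨h1, h2⟩ | ⟨h1, h2⟩ | ⟨h1, q, h2⟩⟩
    · refine ⟨Sum.inl (Sum.inl ⟨_, h1⟩), Subtype.ext ?_⟩
      refine Eq.trans ?_ (hmk Ψ)
      rw [h2]
      rfl
    · refine ⟨Sum.inl (Sum.inr ⟨_, h2⟩), Subtype.ext ?_⟩
      refine Eq.trans ?_ (hmk Ψ)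
      rw [h1]
      rfl
    · refine ⟨Sum.inr ⟨⟨_, h1⟩, ⟨half Ψ 1, q, h2.symm⟩⟩, Subtype.ext ?_⟩
      exact hmk Ψ

instance R_finite (n : ℕ) : Finite (R n) := by
  induction n with
  | zero => exact Set.finite_singleton _
  | succ n ih => exact Finite.of_surjective _ (Rmap_bij n).2

theorem card_R_succ (n : ℕ) : Nat.card (R (n + 1)) = 2 * (2 ^ (n + 1) + 1) * Nat.card (R n) := by
  rw [← Nat.card_congr (Equiv.ofBijective _ (Rmap_bij n)), Nat.card_sum, Nat.card_sum]
  have := Fintype.ofFinite (R n)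
  rw [Nat.card_sigma, Finset.sum_congr rfl (fun r _ => card_orbit (R_T r.2))]
  simp only [Finset.sum_const, Finset.card_univ, smul_eq_mul, Nat.card_eq_fintype_card]
  ring

theorem card_R_zero : Nat.card (R 0) = 1 := by
  show Nat.card ({fun _ => 1} : Set (QState 0)) = 1
  simp

/-! ### Normalization -/

theorem qInner_smul {n : ℕ} (c : ℂ) (ψ : QState n) :
    qInner (c • ψ) (c • ψ) = (Complex.normSq c : ℂ) * qInner ψ ψ := by
  simp only [qInner, Finset.mul_sum, Pi.smul_apply, smul_eq_mul, map_mul]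
  refine Finset.sum_congr rfl fun b _ => ?_
  rw [Complex.normSq_eq_conj_mul_self]
  ring

theorem qInner_self {n : ℕ} (ψ : QState n) :
    qInner ψ ψ = ((∑ b, Complex.normSq (ψ b) : ℝ) : ℂ) := by
  simp [qInner, Complex.normSq_eq_conj_mul_self]

theorem ne_zero_of_qInner {n : ℕ} {ψ : QState n} (h : qInner ψ ψ = 1) : ψ ≠ 0 := by
  rintro rfl
  simp [qInner] at h

theorem stab_iff {n : ℕ} (ψ : QState n) : IsStabilizerState n ψ ↔ qInner ψ ψ = 1 ∧ T ψ := by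
  rw [IsStabilizerState, stabGroup_ncard, T]
  constructor
  · rintro ⟨h1, h2⟩; exact ⟨h1, ne_zero_of_qInner h1, h2⟩
  · rintro ⟨h1, _, h2⟩; exact ⟨h1, h2⟩

theorem exists_norm {n : ℕ} {ψ : QState n} (h : T ψ) :
    ∃ c : ℂ, c ≠ 0 ∧ IsStabilizerState n (c • ψ) := by
  set s : ℝ := ∑ b, Complex.normSq (ψ b) with hs
  have hpos : 0 < s := by
    obtain ⟨b, hb⟩ := Function.ne_iff.1 h.1
    exact Finset.sum_pos' (fun _ _ => Complex.normSq_nonneg _)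
      ⟨b, Finset.mem_univ _, Complex.normSq_pos.2 hb⟩
  have hc : (((Real.sqrt s)⁻¹ : ℝ) : ℂ) ≠ 0 := by
    have : 0 < Real.sqrt s := Real.sqrt_pos.2 hpos
    exact_mod_cast (inv_pos.2 this).ne'
  refine ⟨(((Real.sqrt s)⁻¹ : ℝ) : ℂ), hc, (stab_iff _).2 ⟨?_, (T_smul hc).2 h⟩⟩
  rw [qInner_smul, qInner_self, ← hs, Complex.normSq_ofReal, ← mul_inv,
    Real.mul_self_sqrt hpos.le, ← Complex.ofReal_mul, inv_mul_cancel₀ hpos.ne', Complex.ofReal_one]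

theorem stabQuotCard_eq (n : ℕ) : stabQuotCard n (fun _ => True) = Nat.card (R n) := by
  have hex := fun r : R n => exists_norm (R_T r.2)
  choose c hc hst using hex
  symm
  refine Nat.card_congr (Equiv.ofBijective
    (fun r : R n => Quot.mk _ ⟨c r • r.1, hst r, trivial⟩) ⟨?_, ?_⟩)
  · intro r s h
    have h1 := Quot.eqvGen_exact h
    have h2 : ∀ a b : {ψ : QState n // IsStabilizerState n ψ ∧ True},
        Relation.EqvGen (fun ψ φ => Parallel ψ.1 φ.1) a b → ∃ d : ℂ, d ≠ 0 ∧ b.1 = d • a.1 := by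
      intro a b hab
      induction hab with
      | rel a b hab =>
        obtain ⟨d, hd⟩ := hab
        refine ⟨d, ?_, hd⟩
        rintro rfl
        rw [zero_smul] at hd
        exact ne_zero_of_qInner b.2.1.1 hd
      | refl a => exact ⟨1, one_ne_zero, (one_smul _ _).symm⟩
      | symm a b _ ih =>
        obtain ⟨d, hd, h⟩ := ih
        exact ⟨d⁻¹, inv_ne_zero hd, by rw [h, smul_smul, inv_mul_cancel₀ hd, one_smul]⟩
      | trans a b e _ _ ih1 ih2 =>
        obtain ⟨d, hd, h⟩ := ih1
        obtain ⟨d', hd', h'⟩ := ih2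
        exact ⟨d' * d, mul_ne_zero hd' hd, by rw [h', h, smul_smul]⟩
    obtain ⟨d, hd, h3⟩ := h2 _ _ h1
    have h3' : c s • s.1 = d • c r • r.1 := h3
    have h4 : s.1 = ((c s)⁻¹ * d * c r) • r.1 := by
      rw [mul_smul, mul_smul, ← h3', smul_smul, inv_mul_cancel₀ (hc s), one_smul]
    have h5 := R_unique (mul_ne_zero (mul_ne_zero (inv_ne_zero (hc s)) hd) (hc r)) r.2
      (h4 ▸ s.2)
    rw [h5, one_smul] at h4
    exact Subtype.ext h4.symm
  · intro x
    induction x using Quot.ind with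
    | mk a =>
      obtain ⟨ψ, hψ, ht⟩ := a
      obtain ⟨d, hd, h⟩ := exists_R ((stab_iff _).1 hψ).2
      refine ⟨⟨_, h⟩, Quot.sound ⟨(c ⟨_, h⟩ * d)⁻¹, ?_⟩⟩
      show ψ = (c ⟨_, h⟩ * d)⁻¹ • c ⟨_, h⟩ • d • ψ
      rw [smul_smul (c _), smul_smul, inv_mul_cancel₀ (mul_ne_zero (hc _) hd), one_smul]

theorem main_formula (n : ℕ) :
    Nat.card (R n) = 2 ^ n * ∏ k ∈ Finset.range n, (2 ^ (n - k) + 1) := by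
  induction n with
  | zero => rw [card_R_zero]; simp
  | succ n ih =>
    rw [card_R_succ, ih, Finset.prod_range_succ']
    simp only [Nat.add_sub_add_right, Nat.sub_zero]
    ring

/-- The number of `n`-qubit stabilizer states (counted up to global phase)
equals `2^n · ∏_{k=0}^{n-1} (2^{n-k}+1)`; equivalently it satisfies the
recurrence `N(n) = 2(2^n+1) N(n-1)` with `N(1) = 6`. -/
theorem card_stabilizer_states :
    (∀ n : ℕ, stabQuotCard n (fun _ => True) =
      2 ^ n * ∏ k ∈ Finset.range n, (2 ^ (n - k) + 1)) ∧
    (∀ n : ℕ, 2 ≤ n → stabQuotCard n (fun _ => True) =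
      2 * (2 ^ n + 1) * stabQuotCard (n - 1) (fun _ => True)) ∧
    stabQuotCard 1 (fun _ => True) = 6 := by
  refine ⟨fun n => ?_, fun n hn => ?_, ?_⟩
  · rw [stabQuotCard_eq, main_formula]
  · obtain ⟨m, rfl⟩ : ∃ m, n = m + 1 := ⟨n - 1, by omega⟩
    rw [stabQuotCard_eq, card_R_succ, Nat.add_sub_cancel, stabQuotCard_eq]
  · rw [stabQuotCard_eq, main_formula]
    simp
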